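/- Let (p_k) be a probability distribution on ℕ₀ with generating function g, extinction probability q ∈ (0,1) (the smallest root of g(x)=x in [0,1]), p_0 > 0, p_0 + p_1 < 1, and mean μ > 2. Then the function h(x) = g(x(1−q)+q) − (1−q)x^2 − q has exactly one zero in (0,1). -/

import Mathlib

open Set Filter Topology

namespace GWAux

/-- Summand of the divided difference of the pgf. -/
noncomputable def T (p : ℕ → ℝ) (q : ℝ) (k : ℕ) (y : ℝ) : ℝ :=
  p k * ∑ i ∈ Finset.range k, y ^ i * q ^ (k - 1 - i)

lemma T_nonneg {p : ℕ → ℝ} (hnn : ∀ k, 0 ≤ p k) {q y : ℝ} (hq : 0 ≤ q) (hy : 0 ≤ y) (k : ℕ) :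
    0 ≤ T p q k y :=
  mul_nonneg (hnn k) (Finset.sum_nonneg fun i _ => by positivity)

lemma T_le {p : ℕ → ℝ} (hnn : ∀ k, 0 ≤ p k) {q y : ℝ} (hq : 0 ≤ q) (hq1 : q ≤ 1)
    (hy : 0 ≤ y) (hy1 : y ≤ 1) (k : ℕ) : T p q k y ≤ (k : ℝ) * p k := by
  unfold T
  rw [mul_comm (k : ℝ)]
  refine mul_le_mul_of_nonneg_left ?_ (hnn k)
  calc _ ≤ ∑ i ∈ Finset.range k, (1 : ℝ) :=
        Finset.sum_le_sum fun i _ =>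
          mul_le_one₀ (pow_le_one₀ hy hy1) (by positivity) (pow_le_one₀ hq hq1)
    _ = k := by simp

lemma T_summable {p : ℕ → ℝ} (hnn : ∀ k, 0 ≤ p k) {q y : ℝ} (hq : 0 ≤ q) (hq1 : q ≤ 1)
    (hy : 0 ≤ y) (hy1 : y ≤ 1) (hs : Summable (fun k : ℕ => (k : ℝ) * p k)) :
    Summable fun k => T p q k y :=
  Summable.of_nonneg_of_le (T_nonneg hnn hq hy) (T_le hnn hq hq1 hy hy1) hs

lemma T_convex {p : ℕ → ℝ} (hnn : ∀ k, 0 ≤ p k) {q u v a b : ℝ} (hq : 0 ≤ q)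
    (hu : 0 ≤ u) (hv : 0 ≤ v) (ha : 0 ≤ a) (hb : 0 ≤ b) (hab : a + b = 1) (k : ℕ) :
    T p q k (a * u + b * v) ≤ a * T p q k u + b * T p q k v := by
  unfold T
  have : (∑ i ∈ Finset.range k, (a * u + b * v) ^ i * q ^ (k - 1 - i)) ≤
      a * (∑ i ∈ Finset.range k, u ^ i * q ^ (k - 1 - i)) +
      b * (∑ i ∈ Finset.range k, v ^ i * q ^ (k - 1 - i)) := by
    rw [Finset.mul_sum, Finset.mul_sum, ← Finset.sum_add_distrib]
    refine Finset.sum_le_sum fun i _ => ?_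
    have h := (convexOn_pow (𝕜 := ℝ) i).2 (mem_Ici.2 hu) (mem_Ici.2 hv) ha hb hab
    simp only [smul_eq_mul] at h
    have h2 := mul_le_mul_of_nonneg_right h (pow_nonneg hq (k - 1 - i))
    linarith
  have h2 := mul_le_mul_of_nonneg_left this (hnn k)
  linarith

lemma near_one {p : ℕ → ℝ} (hnn : ∀ k, 0 ≤ p k) (hps : Summable p) (hsum : ∑' k, p k = 1)
    (hs : Summable (fun k : ℕ => (k : ℝ) * p k))
    (hmean : 2 < ∑' k : ℕ, (k : ℝ) * p k) :
    ∃ c < (1 : ℝ), ∀ y ∈ Ioo c 1, 0 ≤ y → (∑' k, p k * y ^ k) < 1 - 2 * (1 - y) := by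
  obtain ⟨N, hN⟩ := (hs.hasSum.tendsto_sum_nat.eventually (lt_mem_nhds hmean)).exists
  have hcont : Continuous fun y : ℝ => ∑ k ∈ Finset.range N, p k * ∑ i ∈ Finset.range k, y ^ i := by
    fun_prop
  have h1 : (2 : ℝ) < ∑ k ∈ Finset.range N, p k * ∑ i ∈ Finset.range k, (1 : ℝ) ^ i := by
    simpa [mul_comm] using hN
  obtain ⟨ε, hε, hb⟩ := Metric.eventually_nhds_iff.1
    (hcont.continuousAt.eventually (lt_mem_nhds h1))
  refine ⟨1 - ε, by linarith, fun y hy hy0 => ?_⟩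
  have hy1 : y ≤ 1 := hy.2.le
  have h2 := hb (y := y) (by rw [Real.dist_eq, abs_lt]; constructor <;> linarith [hy.1, hy.2])
  have hgs : Summable fun k => p k * y ^ k :=
    Summable.of_nonneg_of_le (fun k => mul_nonneg (hnn k) (by positivity))
      (fun k => mul_le_of_le_one_right (hnn k) (pow_le_one₀ hy0 hy1)) hps
  have h3 : ∑ k ∈ Finset.range N, (p k - p k * y ^ k) ≤ ∑' k, (p k - p k * y ^ k) :=
    (hps.sub hgs).sum_le_tsum _ fun k _ =>
      sub_nonneg.2 (mul_le_of_le_one_right (hnn k) (pow_le_one₀ hy0 hy1))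
  rw [hps.tsum_sub hgs, hsum] at h3
  have h4 : ∑ k ∈ Finset.range N, (p k - p k * y ^ k) =
      (∑ k ∈ Finset.range N, p k * ∑ i ∈ Finset.range k, y ^ i) * (1 - y) := by
    rw [Finset.sum_mul]
    refine Finset.sum_congr rfl fun k _ => ?_
    rw [mul_assoc, geom_sum_mul_neg]; ring
  rw [h4] at h3
  have := mul_lt_mul_of_pos_right h2 (sub_pos.2 hy.2)
  linarith

end GWAux

open GWAux in
/-- With pgf `g`, extinction probability `q ∈ (0,1)` (smallest fixed point of `g` in `[0,1]`),
`p 0 > 0`, `p 0 + p 1 < 1` and mean `> 2`, the function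
`h x = g (x*(1-q)+q) - (1-q)*x^2 - q` has exactly one zero in `(0,1)`. -/
theorem stmt_2 (p : ℕ → ℝ) (hnn : ∀ k, 0 ≤ p k) (hsum : ∑' k, p k = 1)
    (q : ℝ) (hq : q ∈ Set.Ioo (0 : ℝ) 1)
    (hfix : (∑' k, p k * q ^ k) = q)
    (hleast : ∀ x ∈ Set.Icc (0 : ℝ) 1, (∑' k, p k * x ^ k) = x → q ≤ x)
    (hp0 : 0 < p 0) (hp01 : p 0 + p 1 < 1)
    (hmean_summable : Summable (fun k : ℕ => (k : ℝ) * p k))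
    (hmean : 2 < ∑' k : ℕ, (k : ℝ) * p k) :
    ∃! x : ℝ, x ∈ Set.Ioo (0 : ℝ) 1 ∧
      (∑' k, p k * (x * (1 - q) + q) ^ k) - (1 - q) * x ^ 2 - q = 0 := by
  obtain ⟨hq0, hq1⟩ := hq
  have hps : Summable p := by
    by_contra h
    rw [tsum_eq_zero_of_not_summable h] at hsum
    norm_num at hsum
  have hgs : ∀ y, 0 ≤ y → y ≤ 1 → Summable fun k => p k * y ^ k := fun y hy0 hy1 =>
    Summable.of_nonneg_of_le (fun k => mul_nonneg (hnn k) (by positivity))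
      (fun k => mul_le_of_le_one_right (hnn k) (pow_le_one₀ hy0 hy1)) hps
  have hTs : ∀ y, 0 ≤ y → y ≤ 1 → Summable fun k => T p q k y := fun y h0 h1 =>
    T_summable hnn hq0.le hq1.le h0 h1 hmean_summable
  set F : ℝ → ℝ := fun x => (∑' k, T p q k (x * (1 - q) + q)) - x with hF
  have hr : ∀ x, 0 ≤ x → x ≤ 1 → 0 ≤ x * (1 - q) + q ∧ x * (1 - q) + q ≤ 1 := by
    intro x h0 h1
    constructor <;> nlinarith
  -- factorization
  have hfac : ∀ x, 0 ≤ x → x ≤ 1 →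
      (∑' k, p k * (x * (1 - q) + q) ^ k) - (1 - q) * x ^ 2 - q = (1 - q) * x * F x := by
    intro x h0 h1
    obtain ⟨hy0, hy1⟩ := hr x h0 h1
    have e : (∑' k, p k * (x * (1 - q) + q) ^ k) - (∑' k, p k * q ^ k) =
        ((1 - q) * x) * ∑' k, T p q k (x * (1 - q) + q) := by
      rw [← (hgs _ hy0 hy1).tsum_sub (hgs q hq0.le hq1.le), ← tsum_mul_left]
      refine tsum_congr fun k => ?_
      have := (Commute.all (x * (1 - q) + q) q).geom_sum₂_mul k
      unfold T
      linear_combination -(p k) * this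
    rw [hfix] at e
    simp only [hF]
    linear_combination e
  have hconv : ∀ u v a b : ℝ, 0 ≤ u → u ≤ 1 → 0 ≤ v → v ≤ 1 → 0 ≤ a → 0 ≤ b → a + b = 1 →
      F (a * u + b * v) ≤ a * F u + b * F v := by
    intro u v a b hu hu1 hv hv1 ha hb hab
    obtain ⟨hy0, hy1⟩ := hr u hu hu1
    obtain ⟨hz0, hz1⟩ := hr v hv hv1
    have e : (a * u + b * v) * (1 - q) + q =
        a * (u * (1 - q) + q) + b * (v * (1 - q) + q) := by
      linear_combination -q * hab
    obtain ⟨hw0, hw1⟩ := hr (a * u + b * v) (by positivity) (by nlinarith)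
    have := Summable.tsum_le_tsum
      (fun k => T_convex (p := p) hnn hq0.le hy0 hz0 ha hb hab k) (e ▸ hTs _ hw0 hw1)
      (((hTs _ hy0 hy1).mul_left a).add ((hTs _ hz0 hz1).mul_left b))
    rw [((hTs _ hy0 hy1).mul_left a).tsum_add ((hTs _ hz0 hz1).mul_left b),
      tsum_mul_left, tsum_mul_left, ← e] at this
    simp only [hF]
    linarith
  have hcont : ContinuousOn F (Icc 0 1) := by
    refine ContinuousOn.sub ?_ continuousOn_id
    refine continuousOn_tsum (u := fun k : ℕ => (k : ℝ) * p k) ?_ hmean_summable ?_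
    · intro k
      unfold T
      fun_prop
    · intro k x hx
      obtain ⟨hy0, hy1⟩ := hr x hx.1 hx.2
      rw [Real.norm_of_nonneg (T_nonneg hnn hq0.le hy0 k)]
      exact T_le hnn hq0.le hq1.le hy0 hy1 k
  have hF0 : 0 < F 0 := by
    have hk : ∃ k : ℕ, 0 < k ∧ 0 < p k := by
      by_contra! h
      have : ∀ k : ℕ, (k : ℝ) * p k = 0 := by
        intro k
        rcases Nat.eq_zero_or_pos k with rfl | hk
        · simp
        · simp [le_antisymm (h k hk) (hnn k)]
      simp only [this, tsum_zero] at hmean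
      norm_num at hmean
    obtain ⟨k, hk0, hpk⟩ := hk
    simp only [hF, zero_mul, zero_add, sub_zero]
    refine (hTs q hq0.le hq1.le).tsum_pos (T_nonneg hnn hq0.le hq0.le) k ?_
    exact mul_pos hpk (Finset.sum_pos (fun i _ => by positivity) ⟨0, by simpa using hk0⟩)
  obtain ⟨c, hc1, hc⟩ := near_one hnn hps hsum hmean_summable hmean
  have hneg : ∀ w < (1 : ℝ), 0 ≤ w → ∃ z, w < z ∧ z < 1 ∧ F z < 0 := by
    intro w hw hw0
    obtain ⟨z, hz1, hz2⟩ := exists_between (max_lt hw (show (c - q) / (1 - q) < 1 by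
      rw [div_lt_one (by linarith)]; linarith))
    have hwz : w < z := (le_max_left _ _).trans_lt hz1
    have hcz : (c - q) / (1 - q) < z := (le_max_right _ _).trans_lt hz1
    rw [div_lt_iff₀ (by linarith)] at hcz
    refine ⟨z, hwz, hz2, ?_⟩
    have hz0 : 0 < z := by linarith
    have h := hc (z * (1 - q) + q) ⟨by linarith, by nlinarith⟩ (hr z hz0.le hz2.le).1
    have h2 := hfac z hz0.le hz2.le
    have h3 : (1 - q) * z * F z < 0 := by
      rw [← h2]
      nlinarith [mul_nonneg (sub_pos.2 hq1).le (sq_nonneg (1 - z))]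
    have h4 : 0 < (1 - q) * z := mul_pos (by linarith) hz0
    by_contra! h5
    exact absurd h3 (not_lt.2 (mul_nonneg h4.le h5))
  have hzero : ∀ x ∈ Ioo (0 : ℝ) 1,
      ((∑' k, p k * (x * (1 - q) + q) ^ k) - (1 - q) * x ^ 2 - q = 0 ↔ F x = 0) := by
    intro x hx
    rw [hfac x hx.1.le hx.2.le]
    have h4 : (1 - q) * x ≠ 0 := (mul_pos (by linarith) hx.1).ne'
    simp only [mul_eq_zero, h4, false_or]
  have huniq : ∀ x y : ℝ, 0 < x → x < y → y < 1 → F x = 0 → F y = 0 → False := by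
    intro x y hx hxy hy hfx hfy
    obtain ⟨z, hyz, hz1, hz⟩ := hneg y hy (by linarith)
    have hd : 0 < z - x := by linarith
    have h := hconv x z ((z - y) / (z - x)) ((y - x) / (z - x)) hx.le (by linarith)
      (by linarith) hz1.le (div_nonneg (by linarith) hd.le) (div_nonneg (by linarith) hd.le)
      (by field_simp; ring)
    have e : (z - y) / (z - x) * x + (y - x) / (z - x) * z = y := by
      field_simp; ring
    rw [e, hfx, hfy] at h
    have : (y - x) / (z - x) * F z < 0 :=
      mul_neg_of_pos_of_neg (div_pos (by linarith) hd) hz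
    linarith
  obtain ⟨z, hz0, hz1, hz⟩ := hneg 0 one_pos le_rfl
  obtain ⟨x, hx, hFx⟩ := intermediate_value_Icc' hz0.le
    (hcont.mono (Icc_subset_Icc le_rfl hz1.le)) (show (0 : ℝ) ∈ Icc (F z) (F 0) from ⟨hz.le, hF0.le⟩)
  have hx0 : 0 < x := lt_of_le_of_ne hx.1 (by rintro rfl; linarith)
  have hxI : x ∈ Ioo (0 : ℝ) 1 := ⟨hx0, hx.2.trans_lt hz1⟩
  refine ⟨x, ⟨hxI, (hzero x hxI).2 hFx⟩, ?_⟩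
  rintro y ⟨hyI, hy⟩
  have hFy := (hzero y hyI).1 hy
  rcases lt_trichotomy y x with h | h | h
  · exact (huniq y x hyI.1 h hxI.2 hFy hFx).elim
  · exact h
  · exact (huniq x y hx0 h hyI.2 hFx hFy).elim
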